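/- Let N ≥ 2, let n ≥ 1, let Nn/2 < s ≤ Nn, let Nn/s < p_1,…,p_N < ∞ and 1/p_1+⋯+1/p_N = 1/p. Set q_k = p_k s/(Nn) for k = 1,…,N. Then there exist weights w_1,…,w_N : ℝⁿ → [0,∞) with (w_1,…,w_N) ∈ A_{(q_1,…,q_N)} such that, for every function Ψ ∈ 𝒮(ℝ^{Nn}) with supp Ψ ⊂ {ξ : 1/2 ≤ |ξ| ≤ 2} and Σ_{k∈ℤ} Ψ(ξ/2^k) = 1 for all ξ ≠ 0, there is NO constant C > 0 for which the inequality ‖T_m(f_1,…,f_N)‖_{L^p(ν_w)} ≤ C · (sup_{j∈ℤ} ‖m_j‖_{W^{(s/N,…,s/N)}(ℝ^{Nn})}) · Π_{k=1}^N ‖f_k‖_{L^{p_k}(w_k)} holds for all m ∈ L^∞(ℝ^{Nn}) and all f_1,…,f_N ∈ 𝒮(ℝⁿ), where m_j(ξ) = m(2^j ξ)Ψ(ξ) and ν_w = Π_{k=1}^N w_k^{p/p_k}. -/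

import Mathlib

open MeasureTheory Real Complex
open scoped RealInnerProductSpace ENNReal BigOperators

noncomputable section

/-- The Fourier transform `f̂(ξ) = ∫ e^{-ix·ξ} f(x) dx` on a Euclidean space. -/
def fint {ι : Type*} [Fintype ι] (f : EuclideanSpace ℝ ι → ℂ) (ξ : EuclideanSpace ℝ ι) : ℂ :=
  ∫ x, Complex.exp (-(Complex.I * ((⟪x, ξ⟫ : ℝ) : ℂ))) * f x

/-- The `k`-th block `ξ_k ∈ ℝⁿ` of `ξ ∈ ℝ^{Nn} = (ℝⁿ)^N`. -/
def blk {N n : ℕ} (ξ : EuclideanSpace ℝ (Fin N × Fin n)) (k : Fin N) :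
    EuclideanSpace ℝ (Fin n) :=
  (WithLp.equiv 2 (Fin n → ℝ)).symm (fun i => ξ (k, i))

/-- The `N`-linear Fourier multiplier operator
`T_m(f₁,…,f_N)(x) = (2π)^{-Nn} ∫ e^{ix·(ξ₁+⋯+ξ_N)} m(ξ) f̂₁(ξ₁)⋯f̂_N(ξ_N) dξ`. -/
def Tm {N n : ℕ} (m : EuclideanSpace ℝ (Fin N × Fin n) → ℂ)
    (f : Fin N → (EuclideanSpace ℝ (Fin n) → ℂ)) (x : EuclideanSpace ℝ (Fin n)) : ℂ :=
  (((2 * π) ^ (N * n) : ℝ) : ℂ)⁻¹ *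
    ∫ ξ, Complex.exp (Complex.I * ((⟪x, ∑ k, blk ξ k⟫ : ℝ) : ℂ)) * m ξ *
      ∏ k, fint (f k) (blk ξ k)

/-- The product-type Sobolev (quasi-)norm
`‖F‖_{W^{(t₁,…,t_N)}(ℝ^{Nn})} = (∫ Π_k (1+|ξ_k|²)^{t_k} |F̂(ξ)|² dξ)^{1/2}`,
with values in `ℝ≥0∞`. -/
def sobolevProd {N n : ℕ} (t : Fin N → ℝ)
    (F : EuclideanSpace ℝ (Fin N × Fin n) → ℂ) : ℝ≥0∞ :=
  (∫⁻ ξ : EuclideanSpace ℝ (Fin N × Fin n),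
    ENNReal.ofReal ((∏ k, (1 + ‖blk ξ k‖ ^ 2) ^ (t k)) * ‖fint F ξ‖ ^ 2)) ^ ((1 : ℝ) / 2)

/-- The weighted Lebesgue (quasi-)norm `‖f‖_{L^q(w)} = (∫ |f|^q w dx)^{1/q}`,
with values in `ℝ≥0∞`. -/
def wLp {n : ℕ} (q : ℝ) (w : EuclideanSpace ℝ (Fin n) → ℝ)
    (f : EuclideanSpace ℝ (Fin n) → ℂ) : ℝ≥0∞ :=
  (∫⁻ x, ENNReal.ofReal (‖f x‖ ^ q * w x)) ^ (1 / q)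

/-- The axis-parallel cube with lower corner `c` and side length `h` in `ℝⁿ`. -/
def cube (n : ℕ) (c : Fin n → ℝ) (h : ℝ) : Set (EuclideanSpace ℝ (Fin n)) :=
  {x | ∀ i, c i ≤ x i ∧ x i ≤ c i + h}

/-- The multilinear Muckenhoupt class `A_{(r₁,…,r_N)}`: here `r : Fin N → ℝ` is the tuple
of exponents and `q` the combined exponent with `1/q = Σ 1/r k`.  Membership means that
`sup_Q (|Q|⁻¹ ∫_Q Π_k w_k^{q/r_k})^{1/q} Π_k (|Q|⁻¹ ∫_Q w_k^{1-r_k'})^{1/r_k'} < ∞`,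
where `1 - r_k' = 1 - r_k/(r_k - 1)` and `1/r_k' = 1 - 1/r_k`. -/
def IsMultiAp (n N : ℕ) (q : ℝ) (r : Fin N → ℝ)
    (w : Fin N → EuclideanSpace ℝ (Fin n) → ℝ) : Prop :=
  ∃ A : ℝ, ∀ (c : Fin n → ℝ) (h : ℝ), 0 < h →
    ((h ^ n)⁻¹ * ∫ x in cube n c h, ∏ k, w k x ^ (q / r k)) ^ (1 / q) *
      ∏ k, ((h ^ n)⁻¹ *
        ∫ x in cube n c h, w k x ^ (1 - r k / (r k - 1))) ^ (1 - 1 / r k) ≤ A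

/-- The product weight `Π_i (1 + |x_i|)`. -/
def prodWeight {n : ℕ} (x : EuclideanSpace ℝ (Fin n)) : ℝ := ∏ i, (1 + |x i|)

lemma one_le_prodWeight {n : ℕ} (x : EuclideanSpace ℝ (Fin n)) : 1 ≤ prodWeight x := by
  calc (1 : ℝ) = ∏ _i : Fin n, 1 := by simp
    _ ≤ prodWeight x := Finset.prod_le_prod (fun _ _ => zero_le_one) fun i _ => by simp

lemma prodWeight_pos {n : ℕ} (x : EuclideanSpace ℝ (Fin n)) : 0 < prodWeight x :=
  one_pos.trans_le (one_le_prodWeight x)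

lemma prodWeight_add_le {n : ℕ} (x y : EuclideanSpace ℝ (Fin n)) :
    prodWeight (x + y) ≤ prodWeight x * prodWeight y := by
  unfold prodWeight
  rw [← Finset.prod_mul_distrib]
  refine Finset.prod_le_prod (fun i _ => by positivity) fun i _ => ?_
  have h1 := abs_add_le (x i) (y i)
  have h2 : 0 ≤ |x i| * |y i| := by positivity
  simp only [PiLp.add_apply]
  nlinarith

lemma prodWeight_neg {n : ℕ} (x : EuclideanSpace ℝ (Fin n)) :
    prodWeight (-x) = prodWeight x := by
  simp [prodWeight]

lemma prodWeight_le {n : ℕ} (x : EuclideanSpace ℝ (Fin n)) :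
    prodWeight x ≤ (1 + ‖x‖) ^ n := by
  unfold prodWeight
  calc ∏ i, (1 + |x i|) ≤ ∏ _i : Fin n, (1 + ‖x‖) := by
        refine Finset.prod_le_prod (fun i _ => by positivity) fun i _ => ?_
        have := PiLp.norm_apply_le x i
        rw [Real.norm_eq_abs] at this
        linarith
    _ = _ := by simp

lemma continuous_prodWeight {n : ℕ} :
    Continuous (prodWeight : EuclideanSpace ℝ (Fin n) → ℝ) := by
  unfold prodWeight
  fun_prop

lemma prodWeight_rpow {n : ℕ} (x : EuclideanSpace ℝ (Fin n)) (b : ℝ) :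
    prodWeight x ^ b = ∏ i, (1 + |x i|) ^ b :=
  (Real.finsetProd_rpow _ _ (fun i _ => by positivity) b).symm

lemma setIntegral_cube_prod {n : ℕ} (c : Fin n → ℝ) (h : ℝ) (g : ℝ → ℝ) :
    ∫ x in cube n c h, ∏ i, g (x i) = ∏ i, ∫ t in Set.Icc (c i) (c i + h), g t := by
  have hc : (WithLp.ofLp : EuclideanSpace ℝ (Fin n) → Fin n → ℝ) ⁻¹'
      (Set.univ.pi fun i => Set.Icc (c i) (c i + h)) = cube n c h := by
    ext x
    simp only [Set.mem_preimage, Set.mem_pi, Set.mem_univ, true_implies, Set.mem_Icc, cube,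
      Set.mem_ofPred_eq]
  rw [← hc]
  have := (PiLp.volume_preserving_ofLp (Fin n)).setIntegral_preimage_emb
    (MeasurableEquiv.toLp 2 (Fin n → ℝ)).symm.measurableEmbedding
    (fun y : Fin n → ℝ => ∏ i, g (y i)) (Set.univ.pi fun i => Set.Icc (c i) (c i + h))
  rw [this, volume_pi, Measure.restrict_pi_pi, integral_fintype_prod_eq_prod]

lemma integral_one_add_abs_rpow_symm {b M : ℝ} (hb : -1 < b) (hM : 0 ≤ M) :
    ∫ t in (-M)..M, (1 + |t|) ^ b = 2 * (((1 + M) ^ (b + 1) - 1) / (b + 1)) := by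
  have hcont : Continuous fun t : ℝ => (1 + |t|) ^ b :=
    (by fun_prop : Continuous fun t : ℝ => 1 + |t|).rpow_const
      fun t => Or.inl (by positivity)
  have h1 : ∫ t in (0 : ℝ)..M, (1 + |t|) ^ b = ((1 + M) ^ (b + 1) - 1) / (b + 1) := by
    have : ∫ t in (0 : ℝ)..M, (1 + |t|) ^ b = ∫ t in (0 : ℝ)..M, (1 + t) ^ b := by
      refine intervalIntegral.integral_congr fun t ht => ?_
      rw [Set.uIcc_of_le hM] at ht
      simp only [abs_of_nonneg ht.1]
    rw [this, intervalIntegral.integral_comp_add_left (fun t => t ^ b), integral_rpow (Or.inl hb)]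
    simp
  have h2 : ∫ t in (-M)..(0 : ℝ), (1 + |t|) ^ b = ∫ t in (0 : ℝ)..M, (1 + |t|) ^ b := by
    rw [← neg_zero, ← intervalIntegral.integral_comp_neg]
    simp
  rw [← intervalIntegral.integral_add_adjacent_intervals (hcont.intervalIntegrable (-M) 0)
    (hcont.intervalIntegrable 0 M), h2, h1]
  ring

lemma average_one_add_abs_rpow_le {b : ℝ} (hb : -1 < b) :
    ∃ C : ℝ, 0 ≤ C ∧ ∀ c h : ℝ, 0 < h →
      h⁻¹ * ∫ t in Set.Icc c (c + h), (1 + |t|) ^ b ≤ C * (1 + max |c| |c + h|) ^ b := by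
  have hcont : Continuous fun t : ℝ => (1 + |t|) ^ b :=
    (by fun_prop : Continuous fun t : ℝ => 1 + |t|).rpow_const
      fun t => Or.inl (by positivity)
  have hsup : ∀ {c h K : ℝ}, 0 < h → (∀ t ∈ Set.Icc c (c + h), (1 + |t|) ^ b ≤ K) →
      h⁻¹ * ∫ t in Set.Icc c (c + h), (1 + |t|) ^ b ≤ K := by
    intro c h K hh hK
    have h1 : ∫ t in Set.Icc c (c + h), (1 + |t|) ^ b ≤ ∫ t in Set.Icc c (c + h), K :=
      setIntegral_mono_on (hcont.continuousOn.integrableOn_Icc)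
        (integrableOn_const (by simp)) measurableSet_Icc hK
    simp only [integral_const, MeasurableSet.univ, measureReal_restrict_apply, Set.univ_inter,
      Real.volume_real_Icc, add_sub_cancel_left, smul_eq_mul, max_eq_left hh.le] at h1
    rw [inv_mul_le_iff₀ hh]
    exact h1
  have habs : ∀ {c h t : ℝ}, t ∈ Set.Icc c (c + h) → |t| ≤ max |c| |c + h| := fun ht =>
    abs_le_max_abs_abs ht.1 ht.2
  rcases le_or_gt 0 b with hb0 | hb0
  · refine ⟨1, zero_le_one, fun c h hh => hsup hh fun t ht => ?_⟩
    rw [one_mul]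
    exact Real.rpow_le_rpow (by positivity) (by linarith [habs ht]) hb0
  refine ⟨2 ^ (-b) + 4 / (b + 1), add_nonneg (by positivity)
    (div_nonneg (by norm_num) (by linarith)), fun c h hh => ?_⟩
  set M := max |c| |c + h| with hMdef
  have hM : 0 ≤ M := le_max_of_le_left (abs_nonneg c)
  have hb1 : 0 < b + 1 := by linarith
  have hcM : |c| ≤ M := le_max_left _ _
  have hchM : |c + h| ≤ M := le_max_right _ _
  have hP : 0 < (1 + M) ^ b := by positivity
  rcases le_or_gt h (M / 2) with hcase | hcase
  · have : h⁻¹ * ∫ t in Set.Icc c (c + h), (1 + |t|) ^ b ≤ 2 ^ (-b) * (1 + M) ^ b := by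
      refine hsup hh fun t ht => ?_
      have ht2 : M / 2 ≤ |t| := by
        rcases max_choice |c| |c + h| with hm | hm
        · rw [← hMdef] at hm
          have := abs_sub_abs_le_abs_sub c t
          have h3 : |c - t| ≤ h := by rw [abs_le]; constructor <;> linarith [ht.1, ht.2]
          linarith
        · rw [← hMdef] at hm
          have := abs_sub_abs_le_abs_sub (c + h) t
          have h3 : |c + h - t| ≤ h := by rw [abs_le]; constructor <;> linarith [ht.1, ht.2]
          linarith
      calc (1 + |t|) ^ b ≤ ((1 + M) / 2) ^ b :=
            Real.rpow_le_rpow_of_nonpos (by positivity) (by linarith) hb0.le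
        _ = 2 ^ (-b) * (1 + M) ^ b := by
            rw [Real.div_rpow (by positivity) (by norm_num), Real.rpow_neg (by norm_num)]
            field_simp
    have h4 : 0 ≤ 4 / (b + 1) * (1 + M) ^ b := by positivity
    linarith [add_mul ((2 : ℝ) ^ (-b)) (4 / (b + 1)) ((1 + M) ^ b)]
  · have h1 : ∫ t in Set.Icc c (c + h), (1 + |t|) ^ b ≤ ∫ t in Set.Icc (-M) M, (1 + |t|) ^ b := by
      refine setIntegral_mono_set hcont.continuousOn.integrableOn_Icc
        (Filter.Eventually.of_forall fun t => by positivity)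
        (Filter.Eventually.of_forall ?_)
      exact Set.Icc_subset_Icc (by linarith [abs_le.1 hcM]) (by linarith [abs_le.1 hchM])
    rw [integral_Icc_eq_integral_Ioc (x := -M), ← intervalIntegral.integral_of_le (by linarith),
      integral_one_add_abs_rpow_symm hb hM] at h1
    have h2 : (1 + M) ^ (b + 1) - 1 ≤ M * (1 + M) ^ b := by
      rw [Real.rpow_add_one (by positivity)]
      have : (1 + M) ^ b ≤ 1 := Real.rpow_le_one_of_one_le_of_nonpos (by linarith) hb0.le
      linarith
    have h3 : h⁻¹ * ∫ t in Set.Icc c (c + h), (1 + |t|) ^ b ≤ 4 / (b + 1) * (1 + M) ^ b := by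
      rw [inv_mul_le_iff₀ hh]
      refine h1.trans ?_
      have : 2 * (((1 + M) ^ (b + 1) - 1) / (b + 1)) ≤ 2 * ((M * (1 + M) ^ b) / (b + 1)) := by
        gcongr
      refine this.trans ?_
      have h5 : h * (4 / (b + 1) * (1 + M) ^ b) - 2 * ((M * (1 + M) ^ b) / (b + 1))
          = (2 * h - M) * (2 * (1 + M) ^ b / (b + 1)) := by
        field_simp
        ring
      have h6 : 0 ≤ (2 * h - M) * (2 * (1 + M) ^ b / (b + 1)) :=
        mul_nonneg (by linarith) (by positivity)
      linarith
    have h4 : 0 ≤ (2 : ℝ) ^ (-b) * (1 + M) ^ b := by positivity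
    linarith [add_mul ((2 : ℝ) ^ (-b)) (4 / (b + 1)) ((1 + M) ^ b)]

lemma average_cube_prodWeight_rpow_le (n : ℕ) {b : ℝ} (hb : -1 < b) :
    ∃ C : ℝ, 0 ≤ C ∧ ∀ (c : Fin n → ℝ) (h : ℝ), 0 < h →
      (h ^ n)⁻¹ * ∫ x in cube n c h, prodWeight x ^ b
        ≤ C * (∏ i, (1 + max |c i| |c i + h|)) ^ b := by
  obtain ⟨C, hC, H⟩ := average_one_add_abs_rpow_le hb
  refine ⟨C ^ n, by positivity, fun c h hh => ?_⟩
  simp_rw [prodWeight_rpow]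
  rw [setIntegral_cube_prod c h (fun t => (1 + |t|) ^ b),
    ← Real.finsetProd_rpow _ _ (fun i _ => by positivity)]
  have e1 : (h ^ n)⁻¹ = ∏ _i : Fin n, h⁻¹ := by simp
  have e2 : C ^ n = ∏ _i : Fin n, C := by simp
  rw [e1, e2, ← Finset.prod_mul_distrib, ← Finset.prod_mul_distrib]
  refine Finset.prod_le_prod (fun i _ => ?_) fun i _ => H (c i) h hh
  exact mul_nonneg (by positivity) (integral_nonneg fun t => by positivity)

/-- Power weights `(Π_i (1 + |x_i|))^{a_k}` belong to `A_{(r_1,…,r_N)}` as soon as all the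
weights occurring in the definition have exponent larger than `-1`. -/
lemma isMultiAp_prodWeight_rpow {n N : ℕ} {q : ℝ} {r a : Fin N → ℝ} (hq : 0 < q)
    (hr : ∀ k, 1 < r k) (h0 : -1 < q * ∑ k, a k / r k) (ha : ∀ k, a k < r k - 1) :
    IsMultiAp n N q r (fun k x => prodWeight x ^ a k) := by
  have hb : ∀ k, -1 < a k * (1 - r k / (r k - 1)) := by
    intro k
    have hrk : 0 < r k - 1 := by linarith [hr k]
    have : a k * (1 - r k / (r k - 1)) = -(a k / (r k - 1)) := by
      field_simp
      ring
    rw [this, neg_lt_neg_iff, div_lt_one hrk]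
    exact ha k
  obtain ⟨C, hC, H⟩ := average_cube_prodWeight_rpow_le n h0
  choose D hD J using fun k => average_cube_prodWeight_rpow_le n (hb k)
  refine ⟨C ^ (1 / q) * ∏ k, D k ^ (1 - 1 / r k), fun c h hh => ?_⟩
  set P : ℝ := ∏ i, (1 + max |c i| |c i + h|) with hPdef
  have hP : 0 < P := Finset.prod_pos fun i _ => by positivity
  have e1 : ∀ x : EuclideanSpace ℝ (Fin n), ∏ k, (prodWeight x ^ a k) ^ (q / r k)
      = prodWeight x ^ (q * ∑ k, a k / r k) := by
    intro x
    rw [Finset.mul_sum, Real.rpow_sum_of_pos (prodWeight_pos x)]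
    refine Finset.prod_congr rfl fun k _ => ?_
    rw [← Real.rpow_mul (prodWeight_pos x).le]
    congr 1
    ring
  have e2 : ∀ k, ∀ x : EuclideanSpace ℝ (Fin n),
      (prodWeight x ^ a k) ^ (1 - r k / (r k - 1))
        = prodWeight x ^ (a k * (1 - r k / (r k - 1))) := fun k x =>
    (Real.rpow_mul (prodWeight_pos x).le _ _).symm
  simp_rw [e1, e2]
  have hexp : ∀ k, 0 < 1 - 1 / r k := fun k => by
    have := (div_lt_one (by linarith [hr k] : 0 < r k)).2 (hr k)
    linarith
  have hnn : ∀ b : ℝ, 0 ≤ (h ^ n)⁻¹ * ∫ x in cube n c h, prodWeight x ^ b := fun b =>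
    mul_nonneg (by positivity)
      (integral_nonneg fun x => Real.rpow_nonneg (prodWeight_pos x).le _)
  calc _ ≤ (C * P ^ (q * ∑ k, a k / r k)) ^ (1 / q) *
        ∏ k, (D k * P ^ (a k * (1 - r k / (r k - 1)))) ^ (1 - 1 / r k) := by
        refine mul_le_mul (Real.rpow_le_rpow (hnn _) (H c h hh) (by positivity))
          (Finset.prod_le_prod (fun k _ => Real.rpow_nonneg (hnn _) _) fun k _ =>
            Real.rpow_le_rpow (hnn _) (J k c h hh) (hexp k).le)
          (Finset.prod_nonneg fun k _ => Real.rpow_nonneg (hnn _) _)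
          (Real.rpow_nonneg (mul_nonneg hC (by positivity)) _)
    _ = C ^ (1 / q) * P ^ (∑ k, a k / r k) *
        ∏ k, (D k ^ (1 - 1 / r k) * P ^ (-(a k / r k))) := by
        congr 1
        · rw [Real.mul_rpow hC (by positivity), ← Real.rpow_mul hP.le]
          congr 2
          field_simp
        · refine Finset.prod_congr rfl fun k _ => ?_
          rw [Real.mul_rpow (hD k) (by positivity), ← Real.rpow_mul hP.le]
          congr 2
          have h1 : r k - 1 ≠ 0 := by linarith [hr k]
          have h2 : r k ≠ 0 := by linarith [hr k]
          field_simp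
          ring
    _ = C ^ (1 / q) * ∏ k, D k ^ (1 - 1 / r k) := by
        rw [Finset.prod_mul_distrib, ← Real.rpow_sum_of_pos hP, Finset.sum_neg_distrib,
          Real.rpow_neg hP.le]
        have := (Real.rpow_pos_of_pos hP (∑ k, a k / r k)).ne'
        field_simp

/-- The vector of `(ℝⁿ)^N` whose `k₀`-th block is `v` and whose other blocks vanish. -/
def embBlk {N n : ℕ} (k₀ : Fin N) (v : EuclideanSpace ℝ (Fin n)) :
    EuclideanSpace ℝ (Fin N × Fin n) :=
  WithLp.toLp 2 fun q => if q.1 = k₀ then v q.2 else 0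

lemma blk_apply {N n : ℕ} (ξ : EuclideanSpace ℝ (Fin N × Fin n)) (k : Fin N) (i : Fin n) :
    blk ξ k i = ξ (k, i) := rfl

lemma inner_embBlk {N n : ℕ} (k₀ : Fin N) (v : EuclideanSpace ℝ (Fin n))
    (η : EuclideanSpace ℝ (Fin N × Fin n)) : ⟪η, embBlk k₀ v⟫ = ⟪blk η k₀, v⟫ := by
  simp only [PiLp.inner_apply, embBlk, blk_apply, Fintype.sum_prod_type]
  rw [Finset.sum_eq_single k₀]
  · simp
  · intro k _ hk
    simp [hk]
  · simp

lemma blk_sub {N n : ℕ} (ξ η : EuclideanSpace ℝ (Fin N × Fin n)) (k : Fin N) :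
    blk (ξ - η) k = blk ξ k - blk η k := rfl

lemma blk_smul {N n : ℕ} (c : ℝ) (ξ : EuclideanSpace ℝ (Fin N × Fin n)) (k : Fin N) :
    blk (c • ξ) k = c • blk ξ k := rfl

lemma blk_embBlk_same {N n : ℕ} (k₀ : Fin N) (v : EuclideanSpace ℝ (Fin n)) :
    blk (embBlk k₀ v) k₀ = v := by
  ext i
  simp [blk_apply, embBlk]

lemma blk_embBlk_ne {N n : ℕ} {k k₀ : Fin N} (h : k ≠ k₀) (v : EuclideanSpace ℝ (Fin n)) :
    blk (embBlk k₀ v) k = 0 := by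
  ext i
  simp [blk_apply, embBlk, h]

lemma continuous_blk {N n : ℕ} (k : Fin N) :
    Continuous fun ξ : EuclideanSpace ℝ (Fin N × Fin n) => blk ξ k := by
  refine (PiLp.continuous_toLp 2 (fun _ : Fin n => ℝ)).comp ?_
  fun_prop

lemma norm_blk_le {N n : ℕ} (ξ : EuclideanSpace ℝ (Fin N × Fin n)) (k : Fin N) :
    ‖blk ξ k‖ ≤ ‖ξ‖ := by
  rw [EuclideanSpace.norm_eq, EuclideanSpace.norm_eq]
  refine Real.sqrt_le_sqrt ?_
  simp only [blk_apply, Fintype.sum_prod_type]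
  exact Finset.single_le_sum (f := fun k => ∑ i, ‖ξ (k, i)‖ ^ 2)
    (fun k _ => Finset.sum_nonneg fun i _ => by positivity) (Finset.mem_univ k)

open scoped FourierTransform in
lemma fint_eq_fourier {ι : Type*} [Fintype ι] (f : EuclideanSpace ℝ ι → ℂ)
    (ξ : EuclideanSpace ℝ ι) : fint f ξ = 𝓕 f ((2 * π)⁻¹ • ξ) := by
  rw [Real.fourier_eq']
  unfold fint
  refine integral_congr_ae (Filter.Eventually.of_forall fun x => ?_)
  simp only [smul_eq_mul, inner_smul_right]
  congr 2
  have : -2 * π * ((2 * π)⁻¹ * ⟪x, ξ⟫) = -⟪x, ξ⟫ := by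
    field_simp
  rw [this]
  push_cast
  ring

/-- Translating a function modulates its Fourier transform. -/
lemma fint_comp_add {ι : Type*} [Fintype ι] (f : EuclideanSpace ℝ ι → ℂ)
    (v ξ : EuclideanSpace ℝ ι) :
    fint (fun x => f (x + v)) ξ = Complex.exp (Complex.I * ((⟪v, ξ⟫ : ℝ) : ℂ)) * fint f ξ := by
  unfold fint
  rw [← integral_const_mul, ← integral_add_right_eq_self (μ := volume)
    (fun x => Complex.exp (Complex.I * ((⟪v, ξ⟫ : ℝ) : ℂ)) *
      (Complex.exp (-(Complex.I * ((⟪x, ξ⟫ : ℝ) : ℂ))) * f x)) v]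
  refine integral_congr_ae (Filter.Eventually.of_forall fun x => ?_)
  simp only
  rw [← mul_assoc, ← Complex.exp_add, inner_add_left]
  congr 2
  push_cast
  ring

/-- Modulating a function translates its Fourier transform. -/
lemma fint_exp_mul {ι : Type*} [Fintype ι] (f : EuclideanSpace ℝ ι → ℂ)
    (v ξ : EuclideanSpace ℝ ι) :
    fint (fun x => Complex.exp (-(Complex.I * ((⟪x, v⟫ : ℝ) : ℂ))) * f x) ξ = fint f (ξ + v) := by
  unfold fint
  refine integral_congr_ae (Filter.Eventually.of_forall fun x => ?_)
  simp only
  rw [← mul_assoc, ← Complex.exp_add, inner_add_right]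
  congr 2
  push_cast
  ring

/-- A Schwartz function decays rapidly. -/
lemma exists_norm_le_one_add_norm_pow {E : Type*} [NormedAddCommGroup E] [NormedSpace ℝ E]
    (f : SchwartzMap E ℂ) (L : ℕ) :
    ∃ C : ℝ, 0 ≤ C ∧ ∀ x, ‖f x‖ ≤ C * ((1 + ‖x‖) ^ L)⁻¹ := by
  refine ⟨2 ^ L * (Finset.Iic (L, 0)).sup (fun m => SchwartzMap.seminorm ℝ m.1 m.2) f,
    by positivity, fun x => ?_⟩
  have := SchwartzMap.one_add_le_sup_seminorm_apply (𝕜 := ℝ) (m := (L, 0)) (le_refl L)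
    (le_refl 0) f x
  rw [norm_iteratedFDeriv_zero] at this
  rw [← div_eq_mul_inv, le_div_iff₀ (by positivity), mul_comm]
  exact this

lemma lintegral_ofReal_lt_top_of_le {E : Type*} [NormedAddCommGroup E] [NormedSpace ℝ E]
    [FiniteDimensional ℝ E] [MeasurableSpace E] [BorelSpace E] (μ : Measure E)
    [μ.IsAddHaarMeasure] {F : E → ℝ} {C r : ℝ} (hr : Module.finrank ℝ E < r)
    (hC : 0 ≤ C) (hF : ∀ x, F x ≤ C * (1 + ‖x‖) ^ (-r)) :
    ∫⁻ x, ENNReal.ofReal (F x) ∂μ < ∞ := by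
  calc ∫⁻ x, ENNReal.ofReal (F x) ∂μ
      ≤ ∫⁻ x, ENNReal.ofReal C * ENNReal.ofReal ((1 + ‖x‖) ^ (-r)) ∂μ := by
        refine lintegral_mono fun x => ?_
        rw [← ENNReal.ofReal_mul hC]
        exact ENNReal.ofReal_le_ofReal (hF x)
    _ = ENNReal.ofReal C * ∫⁻ x, ENNReal.ofReal ((1 + ‖x‖) ^ (-r)) ∂μ :=
        lintegral_const_mul' _ _ ENNReal.ofReal_ne_top
    _ < ∞ := ENNReal.mul_lt_top ENNReal.ofReal_lt_top (finite_integral_one_add_norm hr)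

lemma wLp_prodWeight_lt_top {n : ℕ} {q : ℝ} (hq : 0 < q) (a : ℝ)
    (f : SchwartzMap (EuclideanSpace ℝ (Fin n)) ℂ) :
    wLp q (fun x => prodWeight x ^ a) ⇑f < ∞ := by
  unfold wLp
  refine ENNReal.rpow_lt_top_of_nonneg (by positivity) (ne_of_lt ?_)
  obtain ⟨L, hL⟩ := exists_nat_gt ((n * |a| + n + 1) / q)
  rw [div_lt_iff₀ hq] at hL
  obtain ⟨C, hC, H⟩ := exists_norm_le_one_add_norm_pow f L
  refine lintegral_ofReal_lt_top_of_le volume (C := C ^ q) (r := n + 1) (by simp)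
    (by positivity) fun x => ?_
  have h1 : (1 : ℝ) ≤ 1 + ‖x‖ := by linarith [norm_nonneg x]
  calc ‖f x‖ ^ q * prodWeight x ^ a
      ≤ (C * ((1 + ‖x‖) ^ L)⁻¹) ^ q * ((1 + ‖x‖) ^ n) ^ |a| := by
        refine mul_le_mul (Real.rpow_le_rpow (norm_nonneg _) (H x) hq.le) ?_
          (Real.rpow_nonneg (prodWeight_pos x).le _) (by positivity)
        exact (Real.rpow_le_rpow_of_exponent_le (one_le_prodWeight x) (le_abs_self a)).trans
          (Real.rpow_le_rpow (prodWeight_pos x).le (prodWeight_le x) (abs_nonneg a))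
    _ = C ^ q * (1 + ‖x‖) ^ (-(L * q) + n * |a|) := by
        rw [Real.mul_rpow hC (by positivity), mul_assoc, ← Real.rpow_natCast, ← Real.rpow_natCast,
          ← Real.rpow_neg (by positivity), ← Real.rpow_mul (by positivity),
          ← Real.rpow_mul (by positivity), ← Real.rpow_add (by positivity)]
        congr 2
        ring
    _ ≤ C ^ q * (1 + ‖x‖) ^ (-(n + 1 : ℝ)) := by
        gcongr
        linarith

/-- Translating away from the origin makes `L^q` norms with negative power weights small. -/
lemma wLp_comp_add_le {n : ℕ} {q a : ℝ} (hq : 0 < q) (ha : a ≤ 0)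
    (f : EuclideanSpace ℝ (Fin n) → ℂ) (v : EuclideanSpace ℝ (Fin n)) :
    wLp q (fun x => prodWeight x ^ a) (fun x => f (x + v)) ≤
      ENNReal.ofReal (prodWeight v ^ (a / q)) * wLp q (fun x => prodWeight x ^ (-a)) f := by
  have hv := prodWeight_pos v
  unfold wLp
  rw [← lintegral_sub_right_eq_self _ v]
  have key : ∫⁻ x, ENNReal.ofReal (‖f (x - v + v)‖ ^ q * prodWeight (x - v) ^ a) ≤
      ENNReal.ofReal (prodWeight v ^ a) *
        ∫⁻ x, ENNReal.ofReal (‖f x‖ ^ q * prodWeight x ^ (-a)) := by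
    rw [← lintegral_const_mul' _ _ ENNReal.ofReal_ne_top]
    refine lintegral_mono fun x => ?_
    rw [← ENNReal.ofReal_mul (by positivity)]
    refine ENNReal.ofReal_le_ofReal ?_
    rw [sub_add_cancel]
    have h1 : prodWeight v ≤ prodWeight x * prodWeight (x - v) := by
      have := prodWeight_add_le x (-(x - v))
      rwa [prodWeight_neg, show x + -(x - v) = v by abel] at this
    have hx := prodWeight_pos x
    have h2 : prodWeight (x - v) ^ a ≤ prodWeight v ^ a * prodWeight x ^ (-a) := by
      rw [Real.rpow_neg hx.le, ← div_eq_mul_inv, ← Real.div_rpow hv.le hx.le]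
      refine Real.rpow_le_rpow_of_nonpos (by positivity) ?_ ha
      rwa [div_le_iff₀' hx]
    calc ‖f x‖ ^ q * prodWeight (x - v) ^ a
        ≤ ‖f x‖ ^ q * (prodWeight v ^ a * prodWeight x ^ (-a)) := by gcongr
      _ = _ := by ring
  refine (ENNReal.rpow_le_rpow key (by positivity)).trans_eq ?_
  rw [ENNReal.mul_rpow_of_nonneg _ _ (by positivity),
    ENNReal.ofReal_rpow_of_nonneg (by positivity) (by positivity), ← Real.rpow_mul hv.le]
  congr 3
  ring

open scoped FourierTransform in
lemma sobolevProd_lt_top {N n : ℕ} (t : Fin N → ℝ)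
    (G : SchwartzMap (EuclideanSpace ℝ (Fin N × Fin n)) ℂ) : sobolevProd t ⇑G < ∞ := by
  unfold sobolevProd
  refine ENNReal.rpow_lt_top_of_nonneg (by positivity) (ne_of_lt ?_)
  obtain ⟨L, hL⟩ := exists_nat_gt (∑ k, 2 * |t k| + (N * n) + 1)
  obtain ⟨C, hC, H⟩ := exists_norm_le_one_add_norm_pow (𝓕 G) L
  have hpi : (0 : ℝ) < 2 * π := by positivity
  set D : ℝ := C * (2 * π) ^ L with hD
  have hD0 : 0 ≤ D := by positivity
  have hdec : ∀ ξ, ‖fint ⇑G ξ‖ ≤ D * ((1 + ‖ξ‖) ^ L)⁻¹ := by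
    intro ξ
    rw [fint_eq_fourier, ← SchwartzMap.fourier_coe]
    refine (H _).trans ?_
    rw [hD, mul_assoc]
    refine mul_le_mul_of_nonneg_left ?_ hC
    rw [← div_eq_mul_inv, inv_eq_one_div, div_le_div_iff₀ (by positivity) (by positivity), one_mul,
      ← mul_pow]
    refine pow_le_pow_left₀ (by positivity) ?_ L
    rw [norm_smul, norm_inv, Real.norm_of_nonneg hpi.le, mul_add, mul_inv_cancel_left₀ hpi.ne']
    have := Real.pi_gt_three
    linarith
  refine lintegral_ofReal_lt_top_of_le volume (C := D ^ 2) (r := N * n + 1) (by simp)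
    (by positivity) fun ξ => ?_
  have h1 : (1 : ℝ) ≤ 1 + ‖ξ‖ := by linarith [norm_nonneg ξ]
  have hprod : ∏ k, (1 + ‖blk ξ k‖ ^ 2) ^ (t k) ≤ (1 + ‖ξ‖) ^ (∑ k, 2 * |t k|) := by
    rw [Real.rpow_sum_of_pos (by positivity)]
    refine Finset.prod_le_prod (fun k _ => by positivity) fun k _ => ?_
    rw [Real.rpow_mul (by positivity)]
    have h2 : (1 : ℝ) ≤ 1 + ‖blk ξ k‖ ^ 2 := by linarith [sq_nonneg ‖blk ξ k‖]
    refine (Real.rpow_le_rpow_of_exponent_le h2 (le_abs_self _)).trans ?_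
    refine Real.rpow_le_rpow (by positivity) ?_ (abs_nonneg _)
    rw [Real.rpow_two]
    nlinarith [norm_blk_le ξ k, norm_nonneg (blk ξ k)]
  calc (∏ k, (1 + ‖blk ξ k‖ ^ 2) ^ (t k)) * ‖fint ⇑G ξ‖ ^ 2
      ≤ (1 + ‖ξ‖) ^ (∑ k, 2 * |t k|) * (D * ((1 + ‖ξ‖) ^ L)⁻¹) ^ 2 := by
        gcongr
        exact hdec ξ
    _ = D ^ 2 * (1 + ‖ξ‖) ^ (∑ k, 2 * |t k| - 2 * L) := by
        rw [Real.rpow_sub (by positivity), mul_comm (2 : ℝ) (L : ℝ), Real.rpow_mul (by positivity),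
          Real.rpow_natCast, Real.rpow_two]
        field_simp
    _ ≤ D ^ 2 * (1 + ‖ξ‖) ^ (-(N * n + 1 : ℝ)) := by
        gcongr
        have : (0 : ℝ) ≤ L := by positivity
        linarith

/-- Modulating by `v` in one block costs at most a factor `(1 + ‖v‖²)^{σ/2}` in the product type
Sobolev norm. -/
lemma sobolevProd_exp_mul_le {N n : ℕ} {σ : ℝ} (hσ : 0 ≤ σ) (k₀ : Fin N)
    (v : EuclideanSpace ℝ (Fin n)) (G : EuclideanSpace ℝ (Fin N × Fin n) → ℂ) :
    sobolevProd (fun _ => σ)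
        (fun η => Complex.exp (-(Complex.I * ((⟪blk η k₀, v⟫ : ℝ) : ℂ))) * G η) ≤
      ENNReal.ofReal ((2 * (1 + ‖v‖ ^ 2)) ^ (σ / 2)) * sobolevProd (fun _ => σ) G := by
  unfold sobolevProd
  simp_rw [← inner_embBlk, fint_exp_mul]
  rw [← lintegral_sub_right_eq_self _ (embBlk k₀ v)]
  simp_rw [sub_add_cancel]
  set K : ℝ := (2 * (1 + ‖v‖ ^ 2)) ^ σ with hK
  have hblk : ∀ ξ, ∏ k, (1 + ‖blk (ξ - embBlk k₀ v) k‖ ^ 2) ^ σ ≤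
      K * ∏ k, (1 + ‖blk ξ k‖ ^ 2) ^ σ := by
    intro ξ
    rw [← Finset.mul_prod_erase _ _ (Finset.mem_univ k₀),
      ← Finset.mul_prod_erase _ (fun k => (1 + ‖blk ξ k‖ ^ 2) ^ σ) (Finset.mem_univ k₀),
      ← mul_assoc]
    have hrest : ∏ k ∈ Finset.univ.erase k₀, (1 + ‖blk (ξ - embBlk k₀ v) k‖ ^ 2) ^ σ =
        ∏ k ∈ Finset.univ.erase k₀, (1 + ‖blk ξ k‖ ^ 2) ^ σ := by
      refine Finset.prod_congr rfl fun k hk => ?_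
      rw [blk_sub, blk_embBlk_ne (Finset.ne_of_mem_erase hk), sub_zero]
    rw [hrest]
    refine mul_le_mul_of_nonneg_right ?_ (Finset.prod_nonneg fun k _ => by positivity)
    rw [hK, ← Real.mul_rpow (by positivity) (by positivity)]
    refine Real.rpow_le_rpow (by positivity) ?_ hσ
    rw [blk_sub, blk_embBlk_same]
    have h1 := norm_sub_le (blk ξ k₀) v
    have h2 : ‖blk ξ k₀ - v‖ ^ 2 ≤ (‖blk ξ k₀‖ + ‖v‖) ^ 2 := by gcongr
    nlinarith [sq_nonneg (‖blk ξ k₀‖ - ‖v‖), sq_nonneg (‖blk ξ k₀‖ * ‖v‖)]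
  have key : ∫⁻ ξ, ENNReal.ofReal
      ((∏ k, (1 + ‖blk (ξ - embBlk k₀ v) k‖ ^ 2) ^ σ) * ‖fint G ξ‖ ^ 2) ≤
      ENNReal.ofReal K *
        ∫⁻ ξ, ENNReal.ofReal ((∏ k, (1 + ‖blk ξ k‖ ^ 2) ^ σ) * ‖fint G ξ‖ ^ 2) := by
    rw [← lintegral_const_mul' _ _ ENNReal.ofReal_ne_top]
    refine lintegral_mono fun ξ => ?_
    rw [← ENNReal.ofReal_mul (by positivity), ← mul_assoc]
    refine ENNReal.ofReal_le_ofReal ?_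
    gcongr
    exact hblk ξ
  refine (ENNReal.rpow_le_rpow key (by positivity)).trans_eq ?_
  rw [ENNReal.mul_rpow_of_nonneg _ _ (by positivity),
    ENNReal.ofReal_rpow_of_nonneg (by positivity) (by positivity), hK,
    ← Real.rpow_mul (by positivity)]
  congr 3
  ring

open scoped FourierTransform in
lemma exists_fint_eq {n : ℕ} {b : EuclideanSpace ℝ (Fin n) → ℝ} (hb : HasCompactSupport b)
    (hb' : ContDiff ℝ ((⊤ : ℕ∞) : WithTop ℕ∞) b) :
    ∃ g : SchwartzMap (EuclideanSpace ℝ (Fin n)) ℂ,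
      ∀ ξ, fint ⇑g ξ = (b ((2 * π)⁻¹ • ξ) : ℂ) := by
  have hc : HasCompactSupport fun x => (b x : ℂ) := hb.comp_left (g := fun t : ℝ => (t : ℂ)) rfl
  have hs : ContDiff ℝ ((⊤ : ℕ∞) : WithTop ℕ∞) fun x => (b x : ℂ) :=
    Complex.ofRealCLM.contDiff.comp hb'
  refine ⟨𝓕⁻ (hc.toSchwartzMap hs), fun ξ => ?_⟩
  rw [fint_eq_fourier, ← SchwartzMap.fourier_coe, FourierTransform.fourier_fourierInv_eq]
  rfl

open scoped FourierTransform in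
lemma continuous_fint {ι : Type*} [Fintype ι] (g : SchwartzMap (EuclideanSpace ℝ ι) ℂ) :
    Continuous (fint ⇑g) := by
  have : fint ⇑g = fun ξ => 𝓕 g ((2 * π)⁻¹ • ξ) := by
    ext ξ
    rw [fint_eq_fourier, SchwartzMap.fourier_coe]
  rw [this]
  exact (𝓕 g).continuous.comp (continuous_const_smul _)

open scoped FourierTransform in
lemma exists_norm_fint_le {ι : Type*} [Fintype ι] (g : SchwartzMap (EuclideanSpace ℝ ι) ℂ) :
    ∃ B : ℝ, ∀ ξ, ‖fint ⇑g ξ‖ ≤ B := by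
  obtain ⟨C, _, H⟩ := exists_norm_le_one_add_norm_pow (𝓕 g) 0
  refine ⟨C, fun ξ => ?_⟩
  rw [fint_eq_fourier, ← SchwartzMap.fourier_coe]
  simpa using H ((2 * π)⁻¹ • ξ)

lemma integrable_mul_prod_fint {N n : ℕ} (Ψ : SchwartzMap (EuclideanSpace ℝ (Fin N × Fin n)) ℝ)
    (g : Fin N → SchwartzMap (EuclideanSpace ℝ (Fin n)) ℂ) :
    Integrable fun ξ => (Ψ ξ : ℂ) * ∏ k, fint ⇑(g k) (blk ξ k) := by
  choose B hB using fun k => exists_norm_fint_le (g k)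
  refine (Ψ.integrable (μ := volume)).ofReal.mul_bdd (c := ∏ k, B k) ?_ ?_
  · exact (continuous_finsetProd _ fun k _ =>
      (continuous_fint (g k)).comp (continuous_blk k)).aestronglyMeasurable
  · refine Filter.Eventually.of_forall fun ξ => ?_
    rw [norm_prod]
    exact Finset.prod_le_prod (fun k _ => norm_nonneg _) fun k _ => hB k _

lemma continuous_Tm {N n : ℕ} (Ψ : SchwartzMap (EuclideanSpace ℝ (Fin N × Fin n)) ℝ)
    (g : Fin N → SchwartzMap (EuclideanSpace ℝ (Fin n)) ℂ) :
    Continuous (Tm (fun ξ => (Ψ ξ : ℂ)) fun k => ⇑(g k)) := by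
  unfold Tm
  refine continuous_const.mul ?_
  have hint := integrable_mul_prod_fint Ψ g
  simp_rw [mul_assoc]
  have hblk : ∀ k, Continuous fun ξ : EuclideanSpace ℝ (Fin N × Fin n) => blk ξ k :=
    continuous_blk
  refine continuous_of_dominated (fun x => ?_) (fun x => ?_) hint.norm ?_
  · refine AEStronglyMeasurable.mul ?_ hint.aestronglyMeasurable
    exact Continuous.aestronglyMeasurable (by fun_prop)
  · refine Filter.Eventually.of_forall fun ξ => ?_
    rw [norm_mul, mul_comm Complex.I, Complex.norm_exp_ofReal_mul_I, one_mul]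
  · refine Filter.Eventually.of_forall fun ξ => ?_
    fun_prop

lemma norm_sq_eq_sum_blk {N n : ℕ} (ξ : EuclideanSpace ℝ (Fin N × Fin n)) :
    ‖ξ‖ ^ 2 = ∑ k, ‖blk ξ k‖ ^ 2 := by
  simp_rw [EuclideanSpace.norm_sq_eq, Fintype.sum_prod_type, blk_apply]

lemma exists_Tm_zero_ne_zero {N n : ℕ} (Ψ : SchwartzMap (EuclideanSpace ℝ (Fin N × Fin n)) ℝ)
    {ξ₀ : EuclideanSpace ℝ (Fin N × Fin n)} (hξ₀ : Ψ ξ₀ ≠ 0) :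
    ∃ g : Fin N → SchwartzMap (EuclideanSpace ℝ (Fin n)) ℂ,
      Tm (fun ξ => (Ψ ξ : ℂ)) (fun k => ⇑(g k)) 0 ≠ 0 := by
  have hopen : IsOpen {ξ | 0 < Ψ ξ₀ * Ψ ξ} :=
    isOpen_lt continuous_const (continuous_const.mul Ψ.continuous)
  obtain ⟨r, hr, hball⟩ := Metric.isOpen_iff.1 hopen ξ₀ (mul_self_pos.2 hξ₀)
  have hpi : (0 : ℝ) < 2 * π := by positivity
  set ρ : ℝ := (2 * π)⁻¹ * (r / (N + 1)) with hρ
  have hρ0 : 0 < ρ := by positivity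
  let b : (k : Fin N) → ContDiffBump ((2 * π)⁻¹ • blk ξ₀ k) := fun k =>
    ⟨ρ / 2, ρ, by positivity, by linarith⟩
  choose g hg using fun k => exists_fint_eq (b k).hasCompactSupport (b k).contDiff
  refine ⟨g, ?_⟩
  set F : EuclideanSpace ℝ (Fin N × Fin n) → ℝ :=
    fun ξ => Ψ ξ * ∏ k, b k ((2 * π)⁻¹ • blk ξ k) with hF
  have hFc : ∀ ξ, (Ψ ξ : ℂ) * ∏ k, fint ⇑(g k) (blk ξ k) = (F ξ : ℂ) := by
    intro ξ
    simp [hF, hg]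
  have hTm : Tm (fun ξ => (Ψ ξ : ℂ)) (fun k => ⇑(g k)) 0 =
      (((2 * π) ^ (N * n) : ℝ) : ℂ)⁻¹ * ((∫ ξ, F ξ : ℝ) : ℂ) := by
    rw [← integral_complex_ofReal]
    simp [Tm, ← hFc]
  have hFint : Integrable F := by
    have := integrable_mul_prod_fint Ψ g
    simp_rw [hFc] at this
    exact this.re
  have hFcont : Continuous F := by
    refine Ψ.continuous.mul (continuous_finsetProd _ fun k _ => ?_)
    have hk := continuous_blk (N := N) (n := n) k
    exact (b k).continuous.comp (by fun_prop : Continuous fun ξ => (2 * π)⁻¹ • blk ξ k)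
  have hnear : ∀ ξ, (∏ k, b k ((2 * π)⁻¹ • blk ξ k)) ≠ 0 → 0 < Ψ ξ₀ * Ψ ξ := by
    intro ξ h
    refine hball ?_
    have hk : ∀ k, ‖blk (ξ - ξ₀) k‖ ≤ r / (N + 1) := by
      intro k
      have h1 : (2 * π)⁻¹ • blk ξ k ∈ Function.support (b k) :=
        Finset.prod_ne_zero_iff.1 h k (Finset.mem_univ k)
      rw [(b k).support_eq, mem_ball_iff_norm, ← smul_sub, norm_smul, norm_inv,
        Real.norm_of_nonneg hpi.le] at h1
      change (2 * π)⁻¹ * ‖blk ξ k - blk ξ₀ k‖ < (2 * π)⁻¹ * (r / (N + 1)) at h1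
      rw [blk_sub]
      exact (lt_of_mul_lt_mul_left h1 (by positivity)).le
    rw [mem_ball_iff_norm]
    refine lt_of_pow_lt_pow_left₀ 2 hr.le ?_
    calc ‖ξ - ξ₀‖ ^ 2 = ∑ k, ‖blk (ξ - ξ₀) k‖ ^ 2 := norm_sq_eq_sum_blk _
      _ ≤ ∑ _k : Fin N, (r / (N + 1)) ^ 2 := by
          gcongr with k
          exact hk k
      _ = N * (r / (N + 1)) ^ 2 := by simp
      _ < r ^ 2 := by
          rw [div_pow, ← mul_div_assoc, div_lt_iff₀ (by positivity)]
          have h2 : (0 : ℝ) ≤ N := by positivity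
          have h3 : (N : ℝ) < (N + 1) ^ 2 := by nlinarith
          have h4 : 0 < r ^ 2 := by positivity
          nlinarith
  have hpos : 0 < ∫ ξ, Ψ ξ₀ * F ξ := by
    refine integral_pos_of_integrable_nonneg_nonzero (x := ξ₀) (by fun_prop)
      (hFint.const_mul _) (fun ξ => ?_) ?_
    · by_cases h : (∏ k, b k ((2 * π)⁻¹ • blk ξ k)) = 0
      · simp only [hF, h, mul_zero, Pi.zero_apply, le_refl]
      · simp only [hF, Pi.zero_apply, ← mul_assoc]
        exact mul_nonneg (hnear ξ h).le (Finset.prod_nonneg fun k _ => (b k).nonneg)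
    · have : ∏ k, b k ((2 * π)⁻¹ • blk ξ₀ k) = 1 := by
        refine Finset.prod_eq_one fun k _ => (b k).one_of_mem_closedBall ?_
        exact Metric.mem_closedBall_self (b k).rIn_pos.le
      simp only [hF, this, mul_one]
      exact (mul_self_pos.2 hξ₀).ne'
  rw [integral_const_mul] at hpos
  rw [hTm]
  refine mul_ne_zero (inv_ne_zero ?_) ?_
  · exact Complex.ofReal_ne_zero.2 (by positivity)
  · exact Complex.ofReal_ne_zero.2 (right_ne_zero_of_mul hpos.ne')

lemma wLp_pos {n : ℕ} {q : ℝ} (hq : 0 < q) {w : EuclideanSpace ℝ (Fin n) → ℝ}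
    (hw : Continuous w) (hw0 : ∀ x, 0 < w x) {F : EuclideanSpace ℝ (Fin n) → ℂ}
    (hF : Continuous F) {x₀ : EuclideanSpace ℝ (Fin n)} (hx₀ : F x₀ ≠ 0) : 0 < wLp q w F := by
  unfold wLp
  have hc : Continuous fun x => ENNReal.ofReal (‖F x‖ ^ q * w x) :=
    ENNReal.continuous_ofReal.comp
      ((hF.norm.rpow_const fun _ => Or.inr hq.le).mul hw)
  rw [pos_iff_ne_zero]
  intro h
  rw [ENNReal.rpow_eq_zero_iff_of_pos (by positivity), lintegral_eq_zero_iff hc.measurable] at h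
  have h0 := congrFun ((Continuous.ae_eq_iff_eq volume hc continuous_zero).1 h) x₀
  have : 0 < ‖F x₀‖ ^ q * w x₀ := mul_pos (Real.rpow_pos_of_pos (norm_pos_iff.2 hx₀) q) (hw0 x₀)
  simp only [Pi.zero_apply, ENNReal.ofReal_eq_zero] at h0
  linarith

/-- Modulating the symbol in one block is undone by translating the corresponding function. -/
lemma Tm_exp_mul {N n : ℕ} (k₀ : Fin N) (v : EuclideanSpace ℝ (Fin n))
    (m : EuclideanSpace ℝ (Fin N × Fin n) → ℂ) (f g : Fin N → EuclideanSpace ℝ (Fin n) → ℂ)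
    (hf₀ : f k₀ = fun x => g k₀ (x + v)) (hf : ∀ k, k ≠ k₀ → f k = g k) :
    Tm (fun η => Complex.exp (-(Complex.I * ((⟪blk η k₀, v⟫ : ℝ) : ℂ))) * m η) f = Tm m g := by
  ext x
  unfold Tm
  congr 1
  refine integral_congr_ae (Filter.Eventually.of_forall fun ξ => ?_)
  simp only
  have hprod : ∏ k, fint (f k) (blk ξ k) =
      Complex.exp (Complex.I * ((⟪blk ξ k₀, v⟫ : ℝ) : ℂ)) * ∏ k, fint (g k) (blk ξ k) := by
    rw [← Finset.mul_prod_erase _ _ (Finset.mem_univ k₀),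
      ← Finset.mul_prod_erase _ (fun k => fint (g k) (blk ξ k)) (Finset.mem_univ k₀), hf₀,
      fint_comp_add, real_inner_comm, mul_assoc]
    congr 2
    exact Finset.prod_congr rfl fun k hk => by rw [hf k (Finset.ne_of_mem_erase hk)]
  rw [hprod, Complex.exp_neg]
  have := Complex.exp_ne_zero (Complex.I * ((⟪blk ξ k₀, v⟫ : ℝ) : ℂ))
  field_simp

lemma exists_sobolevProd_le {N n : ℕ} {σ : ℝ} (hσ : 0 ≤ σ) (k₀ : Fin N)
    (Ψ : SchwartzMap (EuclideanSpace ℝ (Fin N × Fin n)) ℝ)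
    (hΨ : tsupport ⇑Ψ ⊆ {ξ | 1 / 2 ≤ ‖ξ‖ ∧ ‖ξ‖ ≤ 2}) :
    ∃ B : ℝ, 0 ≤ B ∧ ∀ (v : EuclideanSpace ℝ (Fin n)) (j : ℤ),
      sobolevProd (fun _ => σ) (fun η =>
        (Complex.exp (-(Complex.I * ((⟪blk ((2 : ℝ) ^ j • η) k₀, v⟫ : ℝ) : ℂ))) *
          (Ψ ((2 : ℝ) ^ j • η) : ℂ)) * (Ψ η : ℂ)) ≤
        ENNReal.ofReal (B * (1 + ‖v‖ ^ 2) ^ (σ / 2)) := by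
  have hsupp : ∀ ξ, Ψ ξ ≠ 0 → 1 / 2 ≤ ‖ξ‖ ∧ ‖ξ‖ ≤ 2 := fun ξ h =>
    hΨ (subset_tsupport _ h)
  set G : ℤ → EuclideanSpace ℝ (Fin N × Fin n) → ℂ :=
    fun j η => (Ψ ((2 : ℝ) ^ j • η) : ℂ) * (Ψ η : ℂ) with hG
  have hcpt : HasCompactSupport ⇑Ψ := by
    refine HasCompactSupport.of_support_subset_isCompact
      (isCompact_closedBall (0 : EuclideanSpace ℝ (Fin N × Fin n)) 2) fun ξ hξ => ?_
    simpa using (hsupp ξ hξ).2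
  have hfin : ∀ j, sobolevProd (fun _ => σ) (G j) < ∞ := by
    intro j
    have hc : HasCompactSupport (G j) :=
      (hcpt.comp_left (g := fun t : ℝ => (t : ℂ)) rfl).mul_left
    have hd : ContDiff ℝ ((⊤ : ℕ∞) : WithTop ℕ∞) (G j) :=
      (Complex.ofRealCLM.contDiff.comp ((Ψ.smooth ⊤).comp (contDiff_const_smul _))).mul
        (Complex.ofRealCLM.contDiff.comp (Ψ.smooth ⊤))
    exact sobolevProd_lt_top _ (hc.toSchwartzMap hd)
  have hzero : ∀ j ∉ Finset.Icc (-2 : ℤ) 2, G j = 0 := by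
    intro j hj
    ext η
    by_contra hne
    simp only [hG, Pi.zero_apply, mul_eq_zero, not_or, Complex.ofReal_eq_zero] at hne
    obtain ⟨h1, h2⟩ := hsupp _ hne.1
    obtain ⟨h3, h4⟩ := hsupp _ hne.2
    have hpos : (0 : ℝ) < 2 ^ j := by positivity
    rw [norm_smul, Real.norm_of_nonneg hpos.le] at h1 h2
    refine hj (Finset.mem_Icc.2 ⟨?_, ?_⟩)
    · rw [← zpow_le_zpow_iff_right₀ (by norm_num : (1 : ℝ) < 2)]
      have : (2 : ℝ) ^ (-2 : ℤ) = 1 / 4 := by norm_num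
      rw [this]
      nlinarith
    · rw [← zpow_le_zpow_iff_right₀ (by norm_num : (1 : ℝ) < 2)]
      have : (2 : ℝ) ^ (2 : ℤ) = 4 := by norm_num
      rw [this]
      nlinarith
  set D : ℝ := ∑ j ∈ Finset.Icc (-2 : ℤ) 2, (sobolevProd (fun _ => σ) (G j)).toReal with hD
  have hD0 : 0 ≤ D := Finset.sum_nonneg fun j _ => ENNReal.toReal_nonneg
  refine ⟨32 ^ (σ / 2) * D, by positivity, fun v j => ?_⟩
  have hrw : (fun η : EuclideanSpace ℝ (Fin N × Fin n) =>
        (Complex.exp (-(Complex.I * ((⟪blk ((2 : ℝ) ^ j • η) k₀, v⟫ : ℝ) : ℂ))) *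
          (Ψ ((2 : ℝ) ^ j • η) : ℂ)) * (Ψ η : ℂ)) =
      fun η => Complex.exp (-(Complex.I * ((⟪blk η k₀, (2 : ℝ) ^ j • v⟫ : ℝ) : ℂ))) * G j η := by
    ext η
    rw [blk_smul, real_inner_smul_left, real_inner_smul_right, hG, mul_assoc]
  rw [hrw]
  refine (sobolevProd_exp_mul_le hσ k₀ _ (G j)).trans ?_
  by_cases hj : j ∈ Finset.Icc (-2 : ℤ) 2
  · have hle : sobolevProd (fun _ => σ) (G j) ≤ ENNReal.ofReal D := by
      rw [← ENNReal.ofReal_toReal (hfin j).ne]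
      exact ENNReal.ofReal_le_ofReal (Finset.single_le_sum
        (f := fun j => (sobolevProd (fun _ => σ) (G j)).toReal)
        (fun j _ => ENNReal.toReal_nonneg) hj)
    have h2 : (2 : ℝ) ^ j ≤ 4 := by
      calc (2 : ℝ) ^ j ≤ 2 ^ (2 : ℤ) :=
            zpow_le_zpow_right₀ (by norm_num) (Finset.mem_Icc.1 hj).2
        _ = 4 := by norm_num
    have hv : ‖(2 : ℝ) ^ j • v‖ ≤ 4 * ‖v‖ := by
      rw [norm_smul, Real.norm_of_nonneg (by positivity)]
      gcongr
    refine (mul_le_mul_right hle _).trans ?_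
    rw [← ENNReal.ofReal_mul (by positivity)]
    refine ENNReal.ofReal_le_ofReal ?_
    have h3 : (2 * (1 + ‖(2 : ℝ) ^ j • v‖ ^ 2)) ^ (σ / 2) ≤ (32 * (1 + ‖v‖ ^ 2)) ^ (σ / 2) := by
      refine Real.rpow_le_rpow (by positivity) ?_ (by positivity)
      have : ‖(2 : ℝ) ^ j • v‖ ^ 2 ≤ (4 * ‖v‖) ^ 2 := by gcongr
      nlinarith
    rw [Real.mul_rpow (x := 32) (by norm_num) (by positivity)] at h3
    calc _ ≤ 32 ^ (σ / 2) * (1 + ‖v‖ ^ 2) ^ (σ / 2) * D := by gcongr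
      _ = _ := by ring
  · have h0 : sobolevProd (fun _ => σ) (G j) = 0 := by
      simp [hzero j hj, sobolevProd, fint]
    rw [h0, mul_zero]
    exact zero_le

/-- Exponents `a_k` for which the weights `prodWeight ^ a_k` satisfy the multilinear Muckenhoupt
condition although one of them is smaller than `-r_k`. -/
lemma exists_exponents {N : ℕ} (hN : 2 ≤ N) {q : ℝ} {r : Fin N → ℝ} (hq0 : 0 < q)
    (hr : ∀ k, 1 < r k) (hq : 1 / q = ∑ k, 1 / r k) :
    ∃ (k₀ : Fin N) (a : Fin N → ℝ) (ε : ℝ), 0 < ε ∧ a k₀ = -(r k₀ * (1 + ε)) ∧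
      (∀ k, a k < r k - 1) ∧ -1 < q * ∑ k, a k / r k := by
  have hr0 : ∀ k, 0 < r k := fun k => one_pos.trans (hr k)
  set k₀ : Fin N := ⟨0, by omega⟩ with hk₀
  set k₁ : Fin N := ⟨1, by omega⟩ with hk₁
  have hne : k₁ ≠ k₀ := by simp [hk₀, hk₁]
  have hsum : ∀ c : Fin N → ℝ, (∀ k, k ≠ k₀ ∧ k ≠ k₁ → c k = 0) → ∑ k, c k = c k₀ + c k₁ :=
    fun c hc => Fintype.sum_eq_add k₀ k₁ hne.symm hc
  set ε : ℝ := 1 / (3 * r k₀) with hε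
  have hε0 : 0 < ε := by have := hr0 k₀; positivity
  set a : Fin N → ℝ := fun k =>
    if k = k₀ then -(r k₀ * (1 + ε)) else if k = k₁ then r k₁ - 1 - ε * r k₁ else 0 with ha
  refine ⟨k₀, a, ε, hε0, by simp [ha], fun k => ?_, ?_⟩
  · simp only [ha]
    split_ifs with h h'
    · rw [h]
      have := hr0 k₀
      have := hr k₀
      nlinarith
    · rw [h']
      have := mul_pos hε0 (hr0 k₁)
      linarith
    · linarith [hr k]
  · rw [hsum _ fun k hk => by simp [ha, hk.1, hk.2]]
    have h1 := hr0 k₀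
    have h2 := hr0 k₁
    have e1 : a k₀ / r k₀ + a k₁ / r k₁ = -(2 * ε + 1 / r k₁) := by
      simp only [ha, if_true, if_neg hne]
      field_simp
      ring
    have e2 : 1 / r k₀ + 1 / r k₁ ≤ 1 / q := by
      rw [hq]
      calc 1 / r k₀ + 1 / r k₁ = ∑ k ∈ {k₀, k₁}, 1 / r k := 
            (Finset.sum_pair (f := fun k => 1 / r k) hne.symm).symm
        _ ≤ _ := Finset.sum_le_univ_sum_of_nonneg fun k => (one_div_pos.2 (hr0 k)).le
    have e3 : 2 * ε < 1 / r k₀ := by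
      have e5 : 2 * ε = 2 / 3 * (1 / r k₀) := by
        rw [hε]
        field_simp
      have : 0 < 1 / r k₀ := by positivity
      linarith
    rw [e1]
    have e4 : q * (2 * ε + 1 / r k₁) < q * (1 / q) := by gcongr; linarith
    rw [mul_one_div_cancel hq0.ne'] at e4
    linarith

/-- Let `N ≥ 2`, `n ≥ 1`, `Nn/2 < s ≤ Nn`, `Nn/s < p_k < ∞`,
`1/p = 1/p₁ + ⋯ + 1/p_N`, and `q_k = p_k s/(Nn)`.  Then there exist nonnegative weights
`w₁,…,w_N` with `(w₁,…,w_N) ∈ A_{(q₁,…,q_N)}` such that for every `Ψ ∈ 𝒮(ℝ^{Nn})`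
supported in `{1/2 ≤ |ξ| ≤ 2}` with `Σ_{k∈ℤ} Ψ(ξ/2^k) = 1` for `ξ ≠ 0`, there is no
constant `C > 0` such that for all bounded measurable `m` and all Schwartz `f₁,…,f_N`,
`‖T_m(f⃗)‖_{L^p(ν_w)} ≤ C · (sup_{j∈ℤ} ‖m(2^j·)Ψ‖_{W^{(s/N,…,s/N)}}) · Π_k ‖f_k‖_{L^{p_k}(w_k)}`
(the supremum over `j` is encoded through an arbitrary upper bound `A` of all the
product-type Sobolev norms of the pieces `m_j`). -/
theorem stmt_0 (N n : ℕ) (hN : 2 ≤ N) (hn : 1 ≤ n) (s p : ℝ) (pk : Fin N → ℝ)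
    (hs1 : (N * n : ℝ) / 2 < s) (hs2 : s ≤ (N * n : ℝ))
    (hpk : ∀ k, (N * n : ℝ) / s < pk k)
    (hp : 1 / p = ∑ k, 1 / pk k) :
    ∃ w : Fin N → EuclideanSpace ℝ (Fin n) → ℝ,
      (∀ k x, 0 ≤ w k x) ∧
      IsMultiAp n N (p * s / (N * n)) (fun k => pk k * s / (N * n)) w ∧
      ∀ Ψ : SchwartzMap (EuclideanSpace ℝ (Fin N × Fin n)) ℝ,
        tsupport ⇑Ψ ⊆ {ξ | 1 / 2 ≤ ‖ξ‖ ∧ ‖ξ‖ ≤ 2} →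
        (∀ ξ : EuclideanSpace ℝ (Fin N × Fin n), ξ ≠ 0 →
          ∑' j : ℤ, Ψ (((2 : ℝ) ^ j)⁻¹ • ξ) = 1) →
        ¬ ∃ C : ℝ, 0 < C ∧
          ∀ m : EuclideanSpace ℝ (Fin N × Fin n) → ℂ,
            Measurable m → (∃ B : ℝ, ∀ ξ, ‖m ξ‖ ≤ B) →
          ∀ A : ℝ,
            (∀ j : ℤ, sobolevProd (fun _ => s / N)
                (fun η => m ((2 : ℝ) ^ j • η) * (Ψ η : ℂ)) ≤ ENNReal.ofReal A) →
          ∀ f : Fin N → SchwartzMap (EuclideanSpace ℝ (Fin n)) ℂ,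
            wLp p (fun x => ∏ k, w k x ^ (p / pk k)) (Tm m (fun k => ⇑(f k)))
              ≤ ENNReal.ofReal C * ENNReal.ofReal A * ∏ k, wLp (pk k) (w k) ⇑(f k) := by
  have hN0 : (0 : ℝ) < N := by exact_mod_cast (by omega : 0 < N)
  have hn0 : (0 : ℝ) < n := by exact_mod_cast hn
  have hNn : (0 : ℝ) < N * n := by positivity
  have hs : 0 < s := by linarith
  have hpk0 : ∀ k, 0 < pk k := fun k => (by positivity : (0 : ℝ) < N * n / s).trans (hpk k)
  have hp0 : 0 < p := by
    rw [← one_div_pos, hp]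
    exact Finset.sum_pos (fun k _ => one_div_pos.2 (hpk0 k)) ⟨⟨0, by omega⟩, Finset.mem_univ _⟩
  have hr : ∀ k, 1 < pk k * s / (N * n) := by
    intro k
    rw [one_lt_div hNn]
    exact (div_lt_iff₀ hs).1 (hpk k)
  have hq0 : 0 < p * s / (N * n) := by positivity
  have hq : 1 / (p * s / (N * n)) = ∑ k, 1 / (pk k * s / (N * n)) := by
    have h1 : ∀ x : ℝ, 1 / (x * s / (N * n)) = N * n / s * (1 / x) := fun x => by
      rw [one_div_div, mul_comm x s, div_mul_div_comm, mul_one]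
    simp_rw [h1, hp, Finset.mul_sum]
  obtain ⟨k₀, a, ε, hε, ha₀, ha, hsum⟩ := exists_exponents hN hq0 hr hq
  refine ⟨fun k x => prodWeight x ^ a k, fun k x => Real.rpow_nonneg (prodWeight_pos x).le _,
    isMultiAp_prodWeight_rpow hq0 hr hsum ha, ?_⟩
  rintro Ψ hΨ hΨ1 ⟨C, hC, H⟩
  obtain ⟨ξ₀, hξ₀⟩ : ∃ ξ, Ψ ξ ≠ 0 := by
    by_contra! h
    have hne : WithLp.toLp 2 (fun _ => 1) ≠ (0 : EuclideanSpace ℝ (Fin N × Fin n)) := by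
      intro h0
      have := congrArg (fun ξ : EuclideanSpace ℝ (Fin N × Fin n) =>
        ξ (⟨0, by omega⟩, ⟨0, by omega⟩)) h0
      simp at this
    simpa [h] using hΨ1 _ hne
  obtain ⟨g, hg⟩ := exists_Tm_zero_ne_zero Ψ hξ₀
  set σ : ℝ := s / N with hσ
  have hσ0 : 0 < σ := by positivity
  obtain ⟨B, hB, hBj⟩ := exists_sobolevProd_le hσ0.le k₀ Ψ hΨ
  set ν : EuclideanSpace ℝ (Fin n) → ℝ := fun x => ∏ k, (prodWeight x ^ a k) ^ (p / pk k) with hν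
  have hpos : 0 < wLp p ν (Tm (fun ξ => (Ψ ξ : ℂ)) fun k => ⇑(g k)) := by
    refine wLp_pos hp0 ?_ (fun x => ?_) (continuous_Tm Ψ g) hg
    · refine continuous_finsetProd _ fun k _ => ?_
      have h1 : Continuous fun x : EuclideanSpace ℝ (Fin n) => prodWeight x ^ a k :=
        continuous_prodWeight.rpow_const fun x => Or.inl (prodWeight_pos x).ne'
      exact h1.rpow_const fun x => Or.inl (Real.rpow_pos_of_pos (prodWeight_pos x) _).ne'
    · exact Finset.prod_pos fun k _ =>
        Real.rpow_pos_of_pos (Real.rpow_pos_of_pos (prodWeight_pos x) _) _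
  have ha₀neg : a k₀ ≤ 0 := by
    have := hr k₀
    rw [ha₀, neg_nonpos]
    positivity
  set K : ℝ≥0∞ := wLp (pk k₀) (fun x => prodWeight x ^ (-a k₀)) ⇑(g k₀) *
    ∏ k ∈ Finset.univ.erase k₀, wLp (pk k) (fun x => prodWeight x ^ a k) ⇑(g k) with hK
  have hKtop : K < ∞ := ENNReal.mul_lt_top (wLp_prodWeight_lt_top (hpk0 k₀) _ _)
    (ENNReal.prod_lt_top fun k _ => wLp_prodWeight_lt_top (hpk0 k) _ _)
  have hexp : n * (a k₀ / pk k₀) = -(σ * (1 + ε)) := by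
    rw [ha₀, hσ]
    have := (hpk0 k₀).ne'
    field_simp
  have hmain : ∀ t : ℝ, 0 ≤ t →
      wLp p ν (Tm (fun ξ => (Ψ ξ : ℂ)) fun k => ⇑(g k)) ≤
        ENNReal.ofReal (C * B * (n : ℝ) ^ (σ / 2) * (1 + t) ^ (-(σ * ε))) * K := by
    intro t ht
    set v : EuclideanSpace ℝ (Fin n) := WithLp.toLp 2 fun _ => t with hv
    have hvn : ‖v‖ ^ 2 = n * t ^ 2 := by
      simp [EuclideanSpace.norm_sq_eq, hv]
    have hvw : prodWeight v = (1 + t) ^ n := by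
      simp [prodWeight, hv, abs_of_nonneg ht]
    set f : Fin N → SchwartzMap (EuclideanSpace ℝ (Fin n)) ℂ :=
      Function.update g k₀ ((g k₀).compSubConstCLM ℂ (-v)) with hf
    have hf₀ : ⇑(f k₀) = fun x => g k₀ (x + v) := by
      ext x
      simp [hf]
    have hfne : ∀ k, k ≠ k₀ → f k = g k := fun k hk => by simp [hf, hk]
    obtain ⟨M, _, hM⟩ := exists_norm_le_one_add_norm_pow
      (SchwartzMap.postcompCLM (𝕜 := ℝ) Complex.ofRealCLM Ψ) 0
    have hmeas : Measurable fun η : EuclideanSpace ℝ (Fin N × Fin n) =>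
        Complex.exp (-(Complex.I * ((⟪blk η k₀, v⟫ : ℝ) : ℂ))) * (Ψ η : ℂ) := by
      have h1 := continuous_blk (N := N) (n := n) k₀
      have h2 := Ψ.continuous
      exact Continuous.measurable (by fun_prop)
    have hbd : ∀ η : EuclideanSpace ℝ (Fin N × Fin n),
        ‖Complex.exp (-(Complex.I * ((⟪blk η k₀, v⟫ : ℝ) : ℂ))) * (Ψ η : ℂ)‖ ≤ M := by
      intro η
      rw [norm_mul, ← mul_neg, ← Complex.ofReal_neg, mul_comm Complex.I,
        Complex.norm_exp_ofReal_mul_I, one_mul]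
      simpa using hM η
    have hineq := H _ hmeas ⟨M, hbd⟩ (B * (1 + ‖v‖ ^ 2) ^ (σ / 2)) (hBj v) f
    rw [Tm_exp_mul k₀ v (fun η => (Ψ η : ℂ)) (fun k => ⇑(f k)) (fun k => ⇑(g k)) hf₀
      fun k hk => by rw [hfne k hk]] at hineq
    refine hineq.trans ?_
    have hf_prod : ∏ k, wLp (pk k) (fun x => prodWeight x ^ a k) ⇑(f k) ≤
        ENNReal.ofReal ((1 + t) ^ (-(σ * (1 + ε)))) * K := by
      rw [← Finset.mul_prod_erase _ _ (Finset.mem_univ k₀), hK, ← mul_assoc]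
      refine mul_le_mul' ?_ (Finset.prod_congr rfl fun k hk => by
        rw [hfne k (Finset.ne_of_mem_erase hk)]).le
      rw [hf₀]
      refine (wLp_comp_add_le (hpk0 k₀) ha₀neg _ v).trans_eq ?_
      rw [hvw, ← Real.rpow_natCast, ← Real.rpow_mul (by positivity), hexp]
    have hA : B * (1 + ‖v‖ ^ 2) ^ (σ / 2) ≤ B * ((n : ℝ) ^ (σ / 2) * (1 + t) ^ σ) := by
      refine mul_le_mul_of_nonneg_left ?_ hB
      have h1 : (1 + t) ^ σ = ((1 + t) ^ 2) ^ (σ / 2) := by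
        rw [← Real.rpow_two, ← Real.rpow_mul (by positivity)]
        congr 1
        ring
      rw [h1, ← Real.mul_rpow (by positivity) (by positivity), hvn]
      refine Real.rpow_le_rpow (by positivity) ?_ (by positivity)
      have : (1 : ℝ) ≤ n := by exact_mod_cast hn
      nlinarith
    calc _ ≤ ENNReal.ofReal C * ENNReal.ofReal (B * ((n : ℝ) ^ (σ / 2) * (1 + t) ^ σ)) *
          (ENNReal.ofReal ((1 + t) ^ (-(σ * (1 + ε)))) * K) := by
          gcongr
      _ = _ := by
          rw [← mul_assoc, ← ENNReal.ofReal_mul hC.le, ← ENNReal.ofReal_mul (by positivity)]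
          congr 2
          have : (1 + t) ^ (-(σ * ε)) = (1 + t) ^ σ * (1 + t) ^ (-(σ * (1 + ε))) := by
            rw [← Real.rpow_add (by positivity)]
            congr 1
            ring
          rw [this]
          ring
  have hlim : Filter.Tendsto (fun t : ℝ =>
      ENNReal.ofReal (C * B * (n : ℝ) ^ (σ / 2) * (1 + t) ^ (-(σ * ε))) * K)
      Filter.atTop (nhds 0) := by
    have h1 : Filter.Tendsto (fun t : ℝ => (1 + t) ^ (-(σ * ε))) Filter.atTop (nhds 0) :=
      (tendsto_rpow_neg_atTop (by positivity)).comp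
        (Filter.tendsto_atTop_add_const_left _ 1 Filter.tendsto_id)
    have h2 := ENNReal.tendsto_ofReal (h1.const_mul (C * B * (n : ℝ) ^ (σ / 2)))
    have h3 := ENNReal.Tendsto.mul_const (b := K) h2 (Or.inr hKtop.ne)
    simpa using h3
  have hle := ge_of_tendsto hlim
    ((Filter.eventually_ge_atTop (0 : ℝ)).mono fun t ht => hmain t ht)
  exact absurd hle (not_le.2 hpos)

end
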